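/- arXiv:1405.1287 — 3 statements merged into one kernel-verified Lean document; each statement's English description precedes it below -/
import Mathlib

section
/- Let P be a general program with atomic heads whose bodies are given in disjunctive normal form. If I is an FLP answer set of P (over the atoms occurring in P), then exp(I) is an FLP answer set of rew^FLP(P). -/
/-- A general rule: a set of atoms as (disjunctive) head, and a generalized
atom (a mapping from interpretations to truth values) as body. -/
structure GRule (B : Type*) where
  head : Set B
  body : Set B → Prop

variable {B : Type*}

/-- `I ⊨ r`. -/
def satRule (I : Set B) (r : GRule B) : Prop :=
  r.body I → (I ∩ r.head).Nonempty

/-- `I ⊨ P`. -/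
def satProg (I : Set B) (P : Set (GRule B)) : Prop :=
  ∀ r ∈ P, satRule I r

/-- The FLP reduct `P^I`. -/
def reduct (P : Set (GRule B)) (I : Set B) : Set (GRule B) :=
  {r ∈ P | r.body I}

/-- `I ⊨_s P`: `I` is a supported model of `P`. -/
def suppModel (I : Set B) (P : Set (GRule B)) : Prop :=
  satProg I P ∧ ∀ a ∈ I, ∃ r ∈ P, r.body I ∧ I ∩ r.head = {a}

/-- `I` is an FLP answer set of `P`. -/
def isFLP (I : Set B) (P : Set (GRule B)) : Prop :=
  satProg I P ∧ ∀ J : Set B, J ⊂ I → ¬ satProg J (reduct P I)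

/-- `I` is an SFLP answer set of `P`. -/
def isSFLP (I : Set B) (P : Set (GRule B)) : Prop :=
  suppModel I P ∧ ∀ J : Set B, J ⊂ I → ¬ suppModel J (reduct P I)

/-- A generalized atom in disjunctive normal form: a (nonempty) list of
disjuncts, each given by its finite set of positive atoms and its finite set
of negative (negated) atoms. -/
abbrev DNF (B : Type*) := List (Finset B × Finset B)

/-- `I ⊨ A` for a DNF generalized atom: some disjunct has all its positive
atoms in `I` and none of its negative atoms in `I`. -/
def satDNF (A : DNF B) (I : Set B) : Prop :=
  ∃ d ∈ A, (∀ x ∈ d.1, x ∈ I) ∧ (∀ x ∈ d.2, x ∉ I)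

/-- A rule with an atomic head and a DNF body. -/
structure DRule (B : Type*) where
  head : B
  body : DNF B

/-- The general rule corresponding to a DNF rule. -/
def DRule.toG (r : DRule B) : GRule B := ⟨{r.head}, satDNF r.body⟩

/-- The general program corresponding to a program with atomic heads and
DNF bodies. -/
def progG (P : Set (DRule B)) : Set (GRule B) := DRule.toG '' P

/-- An atom occurs in a DNF program if it is the head of some rule or occurs
in some disjunct of some body. -/
def occursD (a : B) (P : Set (DRule B)) : Prop :=
  ∃ r ∈ P, r.head = a ∨ ∃ d ∈ r.body, a ∈ d.1 ∨ a ∈ d.2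

/-- The extended vocabulary: the original atoms (`Sum.inl`), plus for each
DNF generalized atom `A` a fresh atom `A^T` and fresh atoms `A^{F_i}`. -/
abbrev V (B : Type*) := B ⊕ (DNF B ⊕ DNF B × ℕ)

/-- An original atom, as an atom of the extended vocabulary. -/
def atm (x : B) : V B := Sum.inl x

/-- The fresh atom `A^T`. -/
def aT (A : DNF B) : V B := Sum.inr (Sum.inl A)

/-- The fresh atom `A^{F_i}`. -/
def aF (A : DNF B) (i : ℕ) : V B := Sum.inr (Sum.inr (A, i))

/-- `tr(A,i)` for the disjunct `d` of `A`: head `{A^T} ∪ (negative atoms of d)`,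
body the conjunction of the positive atoms of `d` and `~A^{F_0}`. -/
def trRule (A : DNF B) (d : Finset B × Finset B) : GRule (V B) :=
  ⟨{aT A} ∪ (atm '' (↑d.2 : Set B)),
   fun I => (∀ x ∈ d.1, atm x ∈ I) ∧ aF A 0 ∉ I⟩

/-- `fls(A,i,j)` for a positive atom `x` of the `(i+1)`-st disjunct (position
`i` in the list): head `{A^{F_{i+1}}}`, body `~x ∧ ~A^T`. -/
def flsPos (A : DNF B) (i : ℕ) (x : B) : GRule (V B) :=
  ⟨{aF A (i + 1)}, fun I => atm x ∉ I ∧ aT A ∉ I⟩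

/-- `fls(A,i,j)` for a negative atom `x` of the `(i+1)`-st disjunct (position
`i` in the list): head `{A^{F_{i+1}}}`, body `x ∧ ~A^T`. -/
def flsNeg (A : DNF B) (i : ℕ) (x : B) : GRule (V B) :=
  ⟨{aF A (i + 1)}, fun I => atm x ∈ I ∧ aT A ∉ I⟩

/-- `fls(A)`: head `{A^{F_0}}`, body `A^{F_1} ∧ … ∧ A^{F_k} ∧ ~A^T`. -/
def flsAll (A : DNF B) : GRule (V B) :=
  ⟨{aF A 0}, fun I => (∀ i < A.length, aF A (i + 1) ∈ I) ∧ aT A ∉ I⟩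

/-- `rew(A)`: all rules `tr(A,i)`, `fls(A,i,j)` and `fls(A)`. -/
def rewAtom (A : DNF B) : Set (GRule (V B)) :=
  {r | ∃ d ∈ A, r = trRule A d} ∪
  {r | ∃ i : Fin A.length, ∃ x ∈ (A.get i).1, r = flsPos A i.val x} ∪
  {r | ∃ i : Fin A.length, ∃ x ∈ (A.get i).2, r = flsNeg A i.val x} ∪
  {flsAll A}

/-- The rule of `rew(P)` obtained from a rule `a ← A` of `P`:
head `{a}`, body the generalized atom true in `I` iff `A^T ∈ I`. -/
def rewRule (r : DRule B) : GRule (V B) :=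
  ⟨{atm r.head}, fun I => aT r.body ∈ I⟩

/-- The generalized atoms occurring as bodies in `P`. -/
def bodies (P : Set (DRule B)) : Set (DNF B) := {A | ∃ r ∈ P, r.body = A}

/-- `rew^FLP(P) = rew(P) ∪ ⋃ {rew(A) | A a body of P}`. -/
def rewFLP (P : Set (DRule B)) : Set (GRule (V B)) :=
  (rewRule '' P) ∪ ⋃ A ∈ bodies P, rewAtom A

/-- `supp(a)`: head `{A_1^T, …, A_n^T}` where `a ← A_1, …, a ← A_n` are all
rules of `P` with head `a`; body true in `I` iff `a ∈ I`. -/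
def suppRule (P : Set (DRule B)) (a : B) : GRule (V B) :=
  ⟨{v | ∃ r ∈ P, r.head = a ∧ v = aT r.body}, fun I => atm a ∈ I⟩

/-- `rew^SFLP(P)`: `rew^FLP(P)` plus `supp(a)` for every atom `a` occurring
in `P`. -/
def rewSFLP (P : Set (DRule B)) : Set (GRule (V B)) :=
  rewFLP P ∪ {r | ∃ a : B, occursD a P ∧ r = suppRule P a}

/-- The expansion `exp(I)` of an interpretation `I` over the atoms of `P`:
`I ∪ {A^T | A a body of P, I ⊨ A} ∪ {A^{F_i} | A a body of P, 0 ≤ i ≤ k, I ⊭ A}`. -/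
def expI (P : Set (DRule B)) (I : Set B) : Set (V B) :=
  (atm '' I) ∪
  {v | ∃ A ∈ bodies P, satDNF A I ∧ v = aT A} ∪
  {v | ∃ A ∈ bodies P, ¬ satDNF A I ∧ ∃ i ≤ A.length, v = aF A i}

/-- The contraction `I|_P` of an interpretation over the extended vocabulary:
its original atoms that occur in `P`. -/
def restr (P : Set (DRule B)) (I : Set (V B)) : Set B :=
  {a | atm a ∈ I ∧ occursD a P}

theorem mem_exp_atm (P : Set (DRule B)) (I : Set B) (x : B) :
    atm x ∈ expI P I ↔ x ∈ I := by
  simp [expI, atm, aT, aF]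

theorem mem_exp_aT (P : Set (DRule B)) (I : Set B) (A : DNF B) :
    aT A ∈ expI P I ↔ A ∈ bodies P ∧ satDNF A I := by
  simp [expI, atm, aT, aF]

theorem mem_exp_aF (P : Set (DRule B)) (I : Set B) (A : DNF B) (i : ℕ) :
    aF A i ∈ expI P I ↔ A ∈ bodies P ∧ ¬ satDNF A I ∧ i ≤ A.length := by
  simp only [expI, atm, aT, aF, Set.mem_union, Set.mem_image, Set.mem_setOf_eq]
  constructor
  · rintro ((⟨x, _, hx⟩ | ⟨A', _, _, hx⟩) | ⟨A', h1, h2, j, h3, hx⟩)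
    · cases hx
    · cases hx
    · cases hx
      exact ⟨h1, h2, h3⟩
  · rintro ⟨h1, h2, h3⟩
    exact Or.inr ⟨A, h1, h2, i, h3, rfl⟩

/-- if I is an FLP answer set of P (over the atoms occurring
in P), then exp(I) is an FLP answer set of rew^FLP(P). -/
theorem stmt10 {B : Type*} (P : Set (DRule B))
    (hk : ∀ r ∈ P, r.body ≠ [])
    (I : Set B) (hI : ∀ a ∈ I, occursD a P)
    (h : isFLP I (progG P)) :
    isFLP (expI P I) (rewFLP P) := by
  obtain ⟨hm, hmin⟩ := h
  constructor
  · rintro r (⟨r, hr, rfl⟩ | hr)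
    · intro hb
      have hb' : aT r.body ∈ expI P I := hb
      rw [mem_exp_aT] at hb'
      obtain ⟨y, hy, hy2⟩ := hm r.toG ⟨r, hr, rfl⟩ hb'.2
      have hy3 : y = r.head := hy2
      subst hy3
      exact ⟨_, (mem_exp_atm P I _).2 hy, rfl⟩
    · simp only [Set.mem_iUnion] at hr
      obtain ⟨A, hA, ((⟨d, hd, rfl⟩ | ⟨i, x, hx, rfl⟩) | ⟨i, x, hx, rfl⟩) | hr⟩ := hr
      · rintro ⟨_, h2⟩
        rw [mem_exp_aF] at h2
        refine ⟨aT A, (mem_exp_aT P I A).2 ⟨hA, ?_⟩, Or.inl rfl⟩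
        by_contra hc
        exact h2 ⟨hA, hc, Nat.zero_le _⟩
      · rintro ⟨_, h2⟩
        rw [mem_exp_aT] at h2
        exact ⟨aF A (i.val + 1), (mem_exp_aF P I A _).2 ⟨hA, fun hc => h2 ⟨hA, hc⟩, i.2⟩, rfl⟩
      · rintro ⟨_, h2⟩
        rw [mem_exp_aT] at h2
        exact ⟨aF A (i.val + 1), (mem_exp_aF P I A _).2 ⟨hA, fun hc => h2 ⟨hA, hc⟩, i.2⟩, rfl⟩
      · have hr' : r = flsAll A := hr
        subst hr'
        rintro ⟨_, h2⟩
        rw [mem_exp_aT] at h2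
        exact ⟨aF A 0, (mem_exp_aF P I A _).2
          ⟨hA, fun hc => h2 ⟨hA, hc⟩, Nat.zero_le _⟩, rfl⟩
  · intro J hJ hsat
    have hsub := hJ.1
    have memR : ∀ A ∈ bodies P, ∀ r ∈ rewAtom A, r ∈ rewFLP P := by
      intro A hA r hr
      refine Or.inr ?_
      simp only [Set.mem_iUnion]
      exact ⟨A, hA, hr⟩
    have hKI : ∀ x, atm x ∈ J → x ∈ I := fun x hx => (mem_exp_atm P I x).1 (hsub hx)
    have key : ∀ A ∈ bodies P, satDNF A I → satDNF A {x | atm x ∈ J} → aT A ∈ J := by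
      rintro A hA hAI ⟨d, hd, hp, hn⟩
      have hF : aF A 0 ∉ expI P I := fun hc => ((mem_exp_aF P I A 0).1 hc).2.1 hAI
      obtain ⟨y, hy, hy2⟩ := hsat (trRule A d)
        ⟨memR A hA _ (Or.inl (Or.inl (Or.inl ⟨d, hd, rfl⟩))),
          fun x hx => hsub (hp x hx), hF⟩ ⟨hp, fun hc => hF (hsub hc)⟩
      rcases hy2 with hy2 | ⟨x, hx, rfl⟩
      · have hy3 : y = aT A := hy2
        exact hy3 ▸ hy
      · exact absurd hy (hn x hx)
    have hK : {x | atm x ∈ J} = I := by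
      by_contra hne
      refine hmin {x | atm x ∈ J} (HasSubset.Subset.ssubset_of_ne hKI hne) ?_
      rintro _ ⟨⟨r, hr, rfl⟩, hb⟩ hbK
      have hT : aT r.body ∈ J := key r.body ⟨r, hr, rfl⟩ hb hbK
      obtain ⟨y, hy, hy2⟩ := hsat (rewRule r) ⟨Or.inl ⟨r, hr, rfl⟩, hsub hT⟩ hT
      have hy3 : y = atm r.head := hy2
      subst hy3
      exact ⟨r.head, hy, rfl⟩
    rw [hK] at key
    have hKm : ∀ x, atm x ∈ J ↔ x ∈ I := fun x => by rw [← hK]; rfl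
    have hFs : ∀ A ∈ bodies P, ¬ satDNF A I → ∀ i < A.length, aF A (i + 1) ∈ J := by
      intro A hA hAI i hi
      have hTe : aT A ∉ expI P I := fun hc => hAI ((mem_exp_aT P I A).1 hc).2
      have hTJ : aT A ∉ J := fun hc => hTe (hsub hc)
      have hcase : (∃ x ∈ (A.get ⟨i, hi⟩).1, x ∉ I) ∨ (∃ x ∈ (A.get ⟨i, hi⟩).2, x ∈ I) := by
        by_contra hc
        push Not at hc
        exact hAI ⟨A.get ⟨i, hi⟩, List.get_mem _ _, hc.1, hc.2⟩
      rcases hcase with ⟨x, hx, hxI⟩ | ⟨x, hx, hxI⟩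
      · obtain ⟨y, hy, hy2⟩ := hsat (flsPos A i x)
          ⟨memR A hA _ (Or.inl (Or.inl (Or.inr ⟨⟨i, hi⟩, x, hx, rfl⟩))),
            fun hc => hxI ((mem_exp_atm P I x).1 hc), hTe⟩
          ⟨fun hc => hxI ((hKm x).1 hc), hTJ⟩
        have hy3 : y = aF A (i + 1) := hy2
        exact hy3 ▸ hy
      · obtain ⟨y, hy, hy2⟩ := hsat (flsNeg A i x)
          ⟨memR A hA _ (Or.inl (Or.inr ⟨⟨i, hi⟩, x, hx, rfl⟩)),
            (mem_exp_atm P I x).2 hxI, hTe⟩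
          ⟨(hKm x).2 hxI, hTJ⟩
        have hy3 : y = aF A (i + 1) := hy2
        exact hy3 ▸ hy
    apply hJ.2
    rintro v ((⟨x, hx, rfl⟩ | ⟨A, hA, hAI, rfl⟩) | ⟨A, hA, hAI, i, hi, rfl⟩)
    · exact (hKm x).2 hx
    · exact key A hA hAI hAI
    · rcases i with _ | i
      · have hTe : aT A ∉ expI P I := fun hc => hAI ((mem_exp_aT P I A).1 hc).2
        obtain ⟨y, hy, hy2⟩ := hsat (flsAll A)
          ⟨memR A hA _ (Or.inr rfl), fun i hi => hsub (hFs A hA hAI i hi), hTe⟩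
          ⟨hFs A hA hAI, fun hc => hTe (hsub hc)⟩
        have hy3 : y = aF A 0 := hy2
        exact hy3 ▸ hy
      · exact hFs A hA hAI i hi
end

section
/- Let P be a general program with atomic heads whose bodies are given in disjunctive normal form. If I is an FLP answer set of rew^FLP(P), then I|_P (the restriction of I to the atoms occurring in P) is an FLP answer set of P. -/
variable {B : Type*}

theorem flp_supp {C : Type*} {Q : Set (GRule C)} {I : Set C} (h : isFLP I Q) {a : C}
    (ha : a ∈ I) : ∃ r ∈ Q, r.body I ∧ a ∈ r.head ∧ ∀ b ∈ r.head, b ∈ I → b = a := by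
  by_contra hc
  push Not at hc
  refine h.2 (I \ {a}) ⟨Set.diff_subset, fun hs => (hs ha).2 rfl⟩ ?_
  rintro r ⟨hr, hb⟩ _
  obtain ⟨b, hbI, hbh⟩ := h.1 r hr hb
  by_cases hba : b = a
  · subst hba
    obtain ⟨c, hc1, hc2, hc3⟩ := hc r hr hb hbh
    exact ⟨c, ⟨hc2, hc3⟩, hc1⟩
  · exact ⟨b, ⟨hbI, hba⟩, hbh⟩

theorem mem_rewFLP {B : Type*} {P : Set (DRule B)} {r : GRule (V B)} :
    r ∈ rewFLP P ↔ (∃ q ∈ P, rewRule q = r) ∨ ∃ A ∈ bodies P,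
      (∃ d ∈ A, r = trRule A d) ∨
      (∃ i : Fin A.length, ∃ x ∈ (A.get i).1, r = flsPos A i.val x) ∨
      (∃ i : Fin A.length, ∃ x ∈ (A.get i).2, r = flsNeg A i.val x) ∨ r = flsAll A := by
  simp only [rewFLP, rewAtom, Set.mem_union, Set.mem_image, Set.mem_iUnion, Set.mem_setOf_eq,
    Set.mem_singleton_iff, exists_prop, or_assoc]

theorem aT_supp {B : Type*} {P : Set (DRule B)} {I : Set (V B)} (h : isFLP I (rewFLP P))
    {A : DNF B} (hA : aT A ∈ I) : satDNF A {x | atm x ∈ I} := by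
  obtain ⟨r, hr, hb, hh, hu⟩ := flp_supp h hA
  rcases mem_rewFLP.1 hr with ⟨q, hq, rfl⟩ | ⟨A', hA', ⟨d, hd, rfl⟩ | ⟨i, x, hx, rfl⟩ |
    ⟨i, x, hx, rfl⟩ | rfl⟩
  · simp [rewRule, aT, atm] at hh
  · have : A = A' := by
      simpa [trRule, aT, atm] using hh
    subst this
    refine ⟨d, hd, hb.1, fun x hx hxI => ?_⟩
    have := hu (atm x) (Or.inr ⟨x, hx, rfl⟩) hxI
    simp [atm, aT] at this
  · simp [flsPos, aT, aF] at hh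
  · simp [flsNeg, aT, aF] at hh
  · simp [flsAll, aT, aF] at hh

theorem aF0_supp {B : Type*} {P : Set (DRule B)} {I : Set (V B)} (h : isFLP I (rewFLP P))
    {A : DNF B} (hA : aF A 0 ∈ I) : ∀ i < A.length, aF A (i + 1) ∈ I := by
  obtain ⟨r, hr, hb, hh, hu⟩ := flp_supp h hA
  rcases mem_rewFLP.1 hr with ⟨q, hq, rfl⟩ | ⟨A', hA', ⟨d, hd, rfl⟩ | ⟨i, x, hx, rfl⟩ |
    ⟨i, x, hx, rfl⟩ | rfl⟩
  · simp [rewRule, aF, atm] at hh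
  · simp [trRule, aT, aF, atm] at hh
  · simp [flsPos, aF] at hh
  · simp [flsNeg, aF] at hh
  · have : A = A' := by
      simpa [flsAll, aF] using hh
    subst this
    exact hb.1

theorem aFi_supp {B : Type*} {P : Set (DRule B)} {I : Set (V B)} (h : isFLP I (rewFLP P))
    {A : DNF B} {i : ℕ} (hi : i < A.length) (hA : aF A (i + 1) ∈ I) :
    ¬ ((∀ x ∈ (A[i]).1, atm x ∈ I) ∧ (∀ x ∈ (A[i]).2, atm x ∉ I)) := by
  rintro ⟨h1, h2⟩
  obtain ⟨r, hr, hb, hh, hu⟩ := flp_supp h hA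
  rcases mem_rewFLP.1 hr with ⟨q, hq, rfl⟩ | ⟨A', hA', ⟨d, hd, rfl⟩ | ⟨j, x, hx, rfl⟩ |
    ⟨j, x, hx, rfl⟩ | rfl⟩
  · simp [rewRule, aF, atm] at hh
  · simp [trRule, aT, aF, atm] at hh
  · have : A = A' ∧ i = j := by
      simpa [flsPos, aF] using hh
    obtain ⟨rfl, rfl⟩ := this
    exact hb.1 (h1 x hx)
  · have : A = A' ∧ i = j := by
      simpa [flsNeg, aF] using hh
    obtain ⟨rfl, rfl⟩ := this
    exact h2 x hx hb.1
  · simp [flsAll, aF] at hh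

theorem aT_of_sat {B : Type*} {P : Set (DRule B)} {I : Set (V B)} (h : isFLP I (rewFLP P))
    {A : DNF B} (hA : A ∈ bodies P) (hs : satDNF A {x | atm x ∈ I}) : aT A ∈ I := by
  by_contra hT
  obtain ⟨d, hd, h1, h2⟩ := hs
  by_cases h0 : aF A 0 ∈ I
  · obtain ⟨i, hi, rfl⟩ := List.mem_iff_getElem.1 hd
    exact aFi_supp h hi (aF0_supp h h0 i hi) ⟨h1, h2⟩
  · obtain ⟨b, hbI, hb⟩ := h.1 (trRule A d)
      (mem_rewFLP.2 (Or.inr ⟨A, hA, Or.inl ⟨d, hd, rfl⟩⟩)) ⟨h1, h0⟩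
    rcases hb with hb | ⟨x, hx, rfl⟩
    · rw [Set.mem_singleton_iff] at hb
      exact hT (hb ▸ hbI)
    · exact h2 x hx hbI

theorem aF0_of_not {B : Type*} {P : Set (DRule B)} {I : Set (V B)} (h : isFLP I (rewFLP P))
    {A : DNF B} (hA : A ∈ bodies P) (hT : aT A ∉ I) : aF A 0 ∈ I := by
  have hs : ¬ satDNF A {x | atm x ∈ I} := fun hs => hT (aT_of_sat h hA hs)
  have key : ∀ i < A.length, aF A (i + 1) ∈ I := by
    intro i hi
    by_contra hF
    refine hs ⟨A[i], List.getElem_mem hi, fun x hx => ?_, fun x hx hxI => ?_⟩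
    · by_contra hxI
      obtain ⟨b, hbI, hb⟩ := h.1 (flsPos A i x)
        (mem_rewFLP.2 (Or.inr ⟨A, hA, Or.inr (Or.inl ⟨⟨i, hi⟩, x, hx, rfl⟩)⟩)) ⟨hxI, hT⟩
      rw [show b = _ from hb] at hbI
      exact hF hbI
    · obtain ⟨b, hbI, hb⟩ := h.1 (flsNeg A i x)
        (mem_rewFLP.2 (Or.inr ⟨A, hA, Or.inr (Or.inr (Or.inl ⟨⟨i, hi⟩, x, hx, rfl⟩))⟩)) ⟨hxI, hT⟩
      rw [show b = _ from hb] at hbI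
      exact hF hbI
  obtain ⟨b, hbI, hb⟩ := h.1 (flsAll A)
    (mem_rewFLP.2 (Or.inr ⟨A, hA, Or.inr (Or.inr (Or.inr rfl))⟩)) ⟨key, hT⟩
  rw [show b = _ from hb] at hbI
  exact hbI

theorem sat_restr {B : Type*} {P : Set (DRule B)} {I : Set (V B)} {A : DNF B}
    (hA : A ∈ bodies P) : satDNF A (restr P I) ↔ satDNF A {x | atm x ∈ I} := by
  obtain ⟨r, hr, rfl⟩ := hA
  constructor
  · rintro ⟨d, hd, h1, h2⟩
    exact ⟨d, hd, fun x hx => (h1 x hx).1,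
      fun x hx hxI => h2 x hx ⟨hxI, r, hr, Or.inr ⟨d, hd, Or.inr hx⟩⟩⟩
  · rintro ⟨d, hd, h1, h2⟩
    exact ⟨d, hd, fun x hx => ⟨h1 x hx, r, hr, Or.inr ⟨d, hd, Or.inl hx⟩⟩,
      fun x hx hxI => h2 x hx hxI.1⟩

/-- if I is an FLP answer set of rew^FLP(P), then I|_P is an
FLP answer set of P. -/
theorem stmt12 {B : Type*} (P : Set (DRule B))
    (hk : ∀ r ∈ P, r.body ≠ [])
    (I : Set (V B)) (h : isFLP I (rewFLP P)) :
    isFLP (restr P I) (progG P) := by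
  constructor
  · rintro _ ⟨r, hr, rfl⟩ hb
    have hA : r.body ∈ bodies P := ⟨r, hr, rfl⟩
    have hT := aT_of_sat h hA ((sat_restr hA).1 hb)
    obtain ⟨b, hbI, hb⟩ := h.1 (rewRule r) (mem_rewFLP.2 (Or.inl ⟨r, hr, rfl⟩)) hT
    rw [show b = _ from hb] at hbI
    exact ⟨r.head, ⟨hbI, r, hr, Or.inl rfl⟩, rfl⟩
  · intro J hJ hsat
    let J' : Set (V B) := {v | v ∈ I ∧ (∀ x, v = atm x → x ∈ J) ∧ ∀ A, v = aT A → satDNF A J}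
    have hatm : ∀ x, atm x ∈ J' ↔ x ∈ J := fun x =>
      ⟨fun hx => hx.2.1 x rfl, fun hx => ⟨(hJ.1 hx).1, fun y hy => by
        rw [← (Sum.inl_injective hy)]; exact hx, fun A hA => by simp [atm, aT] at hA⟩⟩
    have hTm : ∀ A, aT A ∈ I → satDNF A J → aT A ∈ J' := fun A h1 h2 =>
      ⟨h1, fun x hx => by simp [atm, aT] at hx, fun A' hA' => by
        have : A = A' := by simpa [aT] using hA'
        exact this ▸ h2⟩
    have hFm : ∀ A i, aF A i ∈ I → aF A i ∈ J' := fun A i h1 =>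
      ⟨h1, fun x hx => by simp [atm, aF] at hx, fun A' hA' => by simp [aT, aF] at hA'⟩
    refine h.2 J' ⟨fun v hv => hv.1, fun hs => hJ.2 fun x hx => (hatm x).1 (hs hx.1)⟩ ?_
    rintro r ⟨hr, hbI⟩ hbJ
    have hhead := h.1 r hr hbI
    rcases mem_rewFLP.1 hr with ⟨q, hq, rfl⟩ | ⟨A, hA, ⟨d, hd, rfl⟩ | ⟨i, x, hx, rfl⟩ |
      ⟨i, x, hx, rfl⟩ | rfl⟩
    · have hA : q.body ∈ bodies P := ⟨q, hq, rfl⟩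
      have hJs : satDNF q.body J := hbJ.2.2 _ rfl
      obtain ⟨b, hb, hb'⟩ := hsat q.toG ⟨⟨q, hq, rfl⟩, (sat_restr hA).2 (aT_supp h hbI)⟩ hJs
      rw [show b = _ from hb'] at hb
      exact ⟨atm q.head, (hatm _).2 hb, rfl⟩
    · have hT : aT A ∈ I := by
        by_contra hT
        exact hbI.2 (aF0_of_not h hA hT)
      by_cases hs : satDNF A J
      · exact ⟨aT A, hTm A hT hs, Or.inl rfl⟩
      · by_contra hne
        refine hs ⟨d, hd, fun x hx => (hatm x).1 (hbJ.1 x hx), fun x hx hxJ => hne ?_⟩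
        exact ⟨atm x, (hatm x).2 hxJ, Or.inr ⟨x, hx, rfl⟩⟩
    all_goals
      obtain ⟨b, hb, hb'⟩ := hhead
      rw [show b = _ from hb'] at hb
      exact ⟨_, hFm _ _ hb, rfl⟩
end

section
/- Let P be a general program with atomic heads whose bodies are given in disjunctive normal form, and let I be an FLP answer set of rew^FLP(P) or of rew^SFLP(P). Then for every generalized atom A occurring as a body in P, with k disjuncts, and for every i ∈ {1,…,k}, exactly one of the two atoms A^T and A^{F_i} belongs to I, i.e., |I ∩ {A^T, A^{F_i}}| = 1. -/
variable {B : Type*}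

theorem flp_supported {C : Type*} (I : Set C) (Q : Set (GRule C)) (h : isFLP I Q)
    (v : C) (hv : v ∈ I) : ∃ r ∈ Q, r.body I ∧ v ∈ r.head := by
  by_contra hc
  push Not at hc
  refine h.2 (I \ {v}) ?_ ?_
  · refine ⟨Set.diff_subset, fun hs => (hs hv).2 rfl⟩
  · intro r hr _
    obtain ⟨w, hwI, hw⟩ := h.1 r hr.1 hr.2
    refine ⟨w, ⟨hwI, ?_⟩, hw⟩
    rintro rfl
    exact hc r hr.1 hr.2 hw

theorem aF_supported {C : Type*} (P : Set (DRule C)) (I : Set (V C)) (Q : Set (GRule (V C)))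
    (hQ : Q ⊆ rewSFLP P) (h : isFLP I Q) (A : DNF C) (i : ℕ) (hv : aF A i ∈ I) :
    aT A ∉ I ∧ (i = 0 → ∀ j < A.length, aF A (j + 1) ∈ I) := by
  obtain ⟨r, hr, hb, hh⟩ := flp_supported I Q h _ hv
  rcases hQ hr with (⟨r', _, rfl⟩ | hr) | ⟨a, _, rfl⟩
  · simp [rewRule, aF, atm] at hh
  · simp only [Set.mem_iUnion] at hr
    obtain ⟨A', _, hr⟩ := hr
    rcases hr with ((⟨d, _, rfl⟩ | ⟨k, x, _, rfl⟩) | ⟨k, x, _, rfl⟩) | hr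
    · simp [trRule, aF, aT, atm] at hh
    · simp [flsPos, aF] at hh
      obtain ⟨rfl, rfl⟩ := hh
      exact ⟨hb.2, by simp⟩
    · simp [flsNeg, aF] at hh
      obtain ⟨rfl, rfl⟩ := hh
      exact ⟨hb.2, by simp⟩
    · rw [Set.mem_singleton_iff] at hr
      subst hr
      simp [flsAll, aF] at hh
      obtain ⟨rfl, rfl⟩ := hh
      exact ⟨hb.2, fun _ => hb.1⟩
  · obtain ⟨r', _, _, h3⟩ := hh
    simp [aF, aT] at h3

theorem stmt15_aux {C : Type*} (P : Set (DRule C)) (I : Set (V C)) (Q : Set (GRule (V C)))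
    (hQ : Q ⊆ rewSFLP P) (hQ' : rewFLP P ⊆ Q) (h : isFLP I Q) (A : DNF C) (hA : A ∈ bodies P)
    (i : ℕ) (hi : i < A.length) (hT : aT A ∉ I) : aF A (i + 1) ∈ I := by
  by_contra hF
  have hsat : ∀ r ∈ rewAtom A, satRule I r := fun r hr =>
    h.1 r (hQ' (Or.inr (Set.mem_biUnion hA hr)))
  have hpos : ∀ x ∈ (A.get ⟨i, hi⟩).1, atm x ∈ I := by
    intro x hx
    by_contra hxI
    obtain ⟨w, hw, hw'⟩ := hsat (flsPos A i x)
      (Or.inl (Or.inl (Or.inr ⟨⟨i, hi⟩, x, hx, rfl⟩))) ⟨hxI, hT⟩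
    rw [show w = aF A (i + 1) from hw'] at hw
    exact hF hw
  have hneg : ∀ x ∈ (A.get ⟨i, hi⟩).2, atm x ∉ I := by
    intro x hx hxI
    obtain ⟨w, hw, hw'⟩ := hsat (flsNeg A i x)
      (Or.inl (Or.inr ⟨⟨i, hi⟩, x, hx, rfl⟩)) ⟨hxI, hT⟩
    rw [show w = aF A (i + 1) from hw'] at hw
    exact hF hw
  have h0 : aF A 0 ∈ I := by
    by_contra h0
    obtain ⟨w, hw, hw'⟩ := hsat (trRule A (A.get ⟨i, hi⟩))
      (Or.inl (Or.inl (Or.inl ⟨_, List.get_mem _ _, rfl⟩))) ⟨hpos, h0⟩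
    rcases hw' with hw' | ⟨x, hx, rfl⟩
    · rw [show w = aT A from hw'] at hw
      exact hT hw
    · exact hneg x hx hw
  exact hF ((aF_supported P I Q hQ h A 0 h0).2 rfl i hi)

/-- if I is an FLP answer set of rew^FLP(P) or of rew^SFLP(P),
then for every body A of P (with k disjuncts) and every i ∈ {1,…,k},
exactly one of A^T and A^{F_i} belongs to I: |I ∩ {A^T, A^{F_i}}| = 1. -/
theorem stmt15 {B : Type*} (P : Set (DRule B))
    (hk : ∀ r ∈ P, r.body ≠ [])
    (I : Set (V B))
    (h : isFLP I (rewFLP P) ∨ isFLP I (rewSFLP P)) :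
    ∀ A ∈ bodies P, ∀ i : ℕ, 1 ≤ i → i ≤ A.length →
      (I ∩ {aT A, aF A i}).ncard = 1 := by
  intro A hA i h1 hi
  obtain ⟨Q, hQ, hQ', h⟩ : ∃ Q, Q ⊆ rewSFLP P ∧ rewFLP P ⊆ Q ∧ isFLP I Q := by
    rcases h with h | h
    · exact ⟨_, Set.subset_union_left, subset_rfl, h⟩
    · exact ⟨_, subset_rfl, Set.subset_union_left, h⟩
  rw [Set.ncard_eq_one]
  by_cases hT : aT A ∈ I
  · have hF : aF A i ∉ I := fun hF => (aF_supported P I Q hQ h A i hF).1 hT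
    refine ⟨aT A, Set.ext fun w => ⟨?_, ?_⟩⟩
    · rintro ⟨hw, rfl | rfl⟩
      · rfl
      · exact absurd hw hF
    · rintro rfl
      exact ⟨hT, Or.inl rfl⟩
  · obtain ⟨j, rfl⟩ : ∃ j, i = j + 1 := ⟨i - 1, by omega⟩
    have hF := stmt15_aux P I Q hQ hQ' h A hA j (by omega) hT
    refine ⟨aF A (j + 1), Set.ext fun w => ⟨?_, ?_⟩⟩
    · rintro ⟨hw, rfl | rfl⟩
      · exact absurd hw hT
      · rfl
    · rintro rfl
      exact ⟨hF, Or.inr rfl⟩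
end
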